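/- The function Ψ satisfies the chain of inequalities: q − 1 − βε < inf_{t>0} tΨ″(t)/Ψ′(t) ≤ liminf_{t→+∞} tΨ″(t)/Ψ′(t) = q − 1 < p − 1 = limsup_{t→+∞} tΨ″(t)/Ψ′(t) ≤ sup_{t>0} tΨ″(t)/Ψ′(t) < p − 1 + βε. -/

import Mathlib

open Filter Topology Real

/-- Two functions with matching derivatives at the junction point `c` glue to a differentiable
function. -/
theorem hasDerivAt_of_eq_left_right {a c : ℝ} {f f₁ f₂ f' : ℝ → ℝ}
    (h₁ : ∀ t, a < t → t ≤ c → f t = f₁ t) (h₂ : ∀ t, c ≤ t → f t = f₂ t)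
    (d₁ : ∀ t, a < t → t ≤ c → HasDerivAt f₁ (f' t) t)
    (d₂ : ∀ t, c ≤ t → HasDerivAt f₂ (f' t) t) {t : ℝ} (ht : a < t) :
    HasDerivAt f (f' t) t := by
  rcases lt_trichotomy t c with h | rfl | h
  · refine (d₁ t ht h.le).congr_of_eventuallyEq ?_
    filter_upwards [Ioo_mem_nhds ht h] with x hx using h₁ x hx.1 hx.2.le
  · have hl : HasDerivWithinAt f (f' t) (Set.Iic t) t := by
      refine (d₁ t ht le_rfl).hasDerivWithinAt.congr_of_eventuallyEq ?_ (h₁ t ht le_rfl)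
      filter_upwards [self_mem_nhdsWithin, mem_nhdsWithin_of_mem_nhds (Ioi_mem_nhds ht)]
        with x hx hx' using h₁ x hx' hx
    have hr : HasDerivWithinAt f (f' t) (Set.Ici t) t :=
      (d₂ t le_rfl).hasDerivWithinAt.congr (fun x hx => h₂ x hx) (h₂ t le_rfl)
    simpa [Set.Iic_union_Ici] using hl.union hr
  · refine (d₂ t h.le).congr_of_eventuallyEq ?_
    filter_upwards [Ioi_mem_nhds h] with x hx using h₂ x (le_of_lt hx)

/-- The index function of `t ^ α * exp (η t)`, where `k` and `d` are the logarithmic-scale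
derivatives `t * dη/dt` and `t * dk/dt`. -/
theorem index_rpow_mul_exp {α : ℝ} {η Ψ k d : ℝ → ℝ}
    (hΨ : ∀ t : ℝ, 0 ≤ t → Ψ t = t ^ α * exp (η t))
    (hη : ∀ t : ℝ, 0 < t → HasDerivAt η (k t / t) t)
    (hk : ∀ t : ℝ, 0 < t → HasDerivAt k (d t / t) t)
    {t : ℝ} (ht : 0 < t) (hpos : α + k t ≠ 0) :
    t * deriv (deriv Ψ) t / deriv Ψ t = α + k t - 1 + d t / (α + k t) := by
  have h1 : ∀ x : ℝ, 0 < x → deriv Ψ x = x ^ (α - 1) * exp (η x) * (α + k x) := by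
    intro x hx
    have hd := (hasDerivAt_rpow_const (p := α) (Or.inl hx.ne')).mul (hη x hx).exp
    have he : Ψ =ᶠ[𝓝 x] (fun y => y ^ α) * fun y => exp (η y) := by
      filter_upwards [Ioi_mem_nhds hx] with y hy using hΨ y (le_of_lt hy)
    rw [(hd.congr_of_eventuallyEq he).deriv, rpow_sub_one hx.ne']
    field_simp
  have h2 : deriv (deriv Ψ) t =
      t ^ (α - 1) * exp (η t) / t * ((α + k t - 1) * (α + k t) + d t) := by
    have hd := ((hasDerivAt_rpow_const (p := α - 1) (Or.inl ht.ne')).mul (hη t ht).exp).mul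
      ((hk t ht).const_add α)
    have he : deriv Ψ =ᶠ[𝓝 t]
        ((fun y => y ^ (α - 1)) * fun y => exp (η y)) * fun y => α + k y := by
      filter_upwards [Ioi_mem_nhds ht] with y hy using h1 y hy
    rw [(hd.congr_of_eventuallyEq he).deriv, rpow_sub_one ht.ne' (α - 1)]
    simp only [Pi.mul_apply]
    field_simp
    ring
  have h3 : t ^ (α - 1) ≠ 0 := (rpow_pos_of_pos ht _).ne'
  have h4 : exp (η t) ≠ 0 := (exp_pos _).ne'
  rw [h1 t ht, h2]
  field_simp

theorem frequently_sin_cos_log_log {ε : ℝ} (hε : 0 < ε) (x : ℝ) :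
    ∃ᶠ t in atTop, sin (ε * log (log t)) = sin x ∧ cos (ε * log (log t)) = cos x := by
  have hlim : Tendsto (fun n : ℕ => exp (exp ((x + n * (2 * π)) / ε))) atTop atTop := by
    refine tendsto_exp_atTop.comp (tendsto_exp_atTop.comp (Tendsto.atTop_div_const hε ?_))
    exact tendsto_atTop_add_const_left _ _
      (tendsto_natCast_atTop_atTop.atTop_mul_const (by positivity))
  refine hlim.frequently (Frequently.of_forall fun n => ?_)
  rw [log_exp, log_exp, mul_div_cancel₀ _ hε.ne']
  exact ⟨sin_add_nat_mul_two_pi x n, cos_add_nat_mul_two_pi x n⟩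

theorem liminf_eq_of_frequently_le {f r : ℝ → ℝ} {a : ℝ}
    (hf : ∃ᶠ t in atTop, f t ≤ a) (hb : ∀ᶠ t in atTop, a - r t ≤ f t)
    (hr : Tendsto r atTop (𝓝 0)) : liminf f atTop = a := by
  have hlow : ∀ δ > 0, ∀ᶠ t in atTop, a - δ ≤ f t := fun δ hδ => by
    filter_upwards [hb, hr.eventually_lt_const hδ] with t h1 h2
    linarith
  refine le_antisymm (liminf_le_of_frequently_le hf ⟨a - 1, hlow 1 one_pos⟩) ?_
  refine le_of_forall_pos_le_add fun δ hδ => ?_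
  have := le_liminf_of_le (IsCoboundedUnder.of_frequently_le hf) (hlow δ hδ)
  linarith

theorem limsup_eq_of_frequently_le {f r : ℝ → ℝ} {a : ℝ}
    (hf : ∃ᶠ t in atTop, a ≤ f t) (hb : ∀ᶠ t in atTop, f t ≤ a + r t)
    (hr : Tendsto r atTop (𝓝 0)) : limsup f atTop = a := by
  have hup : ∀ δ > 0, ∀ᶠ t in atTop, f t ≤ a + δ := fun δ hδ => by
    filter_upwards [hb, hr.eventually_lt_const hδ] with t h1 h2
    linarith
  refine le_antisymm ?_ (le_limsup_of_frequently_le hf ⟨a + 1, hup 1 one_pos⟩)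
  exact le_of_forall_pos_le_add fun δ hδ =>
    limsup_le_of_le (IsCoboundedUnder.of_frequently_ge hf) (hup δ hδ)

/-- The scaled derivative `t * dη/dt` of the exponent `η`. -/
noncomputable def etaSlope (β ε t : ℝ) : ℝ :=
  if t ≤ exp 1 then -(β * ε / exp 1 ^ 2) * (t * (exp 1 - t)) else β * sin (ε * log (log t))

/-- The scaled derivative `t * d/dt (etaSlope β ε t)`. -/
noncomputable def etaSlopeDeriv (β ε t : ℝ) : ℝ :=
  if t ≤ exp 1 then -(β * ε / exp 1 ^ 2) * (t * (exp 1 - 2 * t))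
  else β * ε * cos (ε * log (log t)) / log t

theorem etaSlope_of_ge {β ε t : ℝ} (ht : exp 1 ≤ t) :
    etaSlope β ε t = β * sin (ε * log (log t)) := by
  rcases ht.eq_or_lt with rfl | h
  · simp [etaSlope]
  · simp [etaSlope, not_le.mpr h]

theorem etaSlopeDeriv_of_ge {β ε t : ℝ} (ht : exp 1 ≤ t) :
    etaSlopeDeriv β ε t = β * ε * cos (ε * log (log t)) / log t := by
  rcases ht.eq_or_lt with rfl | h
  · simp only [etaSlopeDeriv, le_refl, if_true, log_exp, log_one, mul_zero, cos_zero]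
    field_simp
    ring
  · simp [etaSlopeDeriv, not_le.mpr h]

theorem one_le_log_of_exp_one_le {t : ℝ} (ht : exp 1 ≤ t) : 1 ≤ log t :=
  (le_log_iff_exp_le ((exp_pos 1).trans_le ht)).mpr ht

theorem hasDerivAt_mul_log_log {ε t : ℝ} (ht : exp 1 ≤ t) :
    HasDerivAt (fun t => ε * log (log t)) (ε * (t⁻¹ / log t)) t := by
  have ht0 : 0 < t := (exp_pos 1).trans_le ht
  have hl := one_le_log_of_exp_one_le ht
  exact ((hasDerivAt_log ht0.ne').log (by positivity)).const_mul ε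

theorem hasDerivAt_etaSlope (β ε : ℝ) {t : ℝ} (ht : 0 < t) :
    HasDerivAt (etaSlope β ε) (etaSlopeDeriv β ε t / t) t := by
  refine hasDerivAt_of_eq_left_right (a := 0) (c := exp 1)
    (f' := fun t => etaSlopeDeriv β ε t / t)
    (f₁ := fun t => -(β * ε / exp 1 ^ 2) * (t * (exp 1 - t)))
    (f₂ := fun t => β * sin (ε * log (log t)))
    (fun x _ hx => if_pos hx) (fun x hx => etaSlope_of_ge hx) ?_ ?_ ht
  · intro x hx0 hx
    have := ((hasDerivAt_id' x).mul ((hasDerivAt_id' x).const_sub (exp 1))).const_mul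
      (-(β * ε / exp 1 ^ 2))
    refine this.congr_deriv ?_
    simp only [etaSlopeDeriv, if_pos hx]
    field_simp
    ring
  · intro x hx
    have hx0 : 0 < x := (exp_pos 1).trans_le hx
    have hl := one_le_log_of_exp_one_le hx
    refine ((hasDerivAt_mul_log_log (ε := ε) hx).sin.const_mul β).congr_deriv ?_
    rw [etaSlopeDeriv_of_ge hx]
    field_simp

theorem hasDerivAt_eta {β ε : ℝ} {η : ℝ → ℝ}
    (hη1 : ∀ t : ℝ, 0 ≤ t → t ≤ exp 1 →
      η t = β * ε / (2 * exp 1 ^ 2) * (exp 1 - t) ^ 2 - β * ε / (1 + ε ^ 2))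
    (hη2 : ∀ t : ℝ, exp 1 ≤ t → η t = β * log t / (1 + ε ^ 2) *
        (sin (ε * log (log t)) - ε * cos (ε * log (log t))))
    {t : ℝ} (ht : 0 < t) : HasDerivAt η (etaSlope β ε t / t) t := by
  refine hasDerivAt_of_eq_left_right (a := 0) (c := exp 1)
    (f' := fun t => etaSlope β ε t / t)
    (fun x hx0 hx => hη1 x hx0.le hx) hη2 ?_ ?_ ht
  · intro x hx0 hx
    have := ((((hasDerivAt_id' x).const_sub (exp 1)).pow 2).const_mul
      (β * ε / (2 * exp 1 ^ 2))).sub_const (β * ε / (1 + ε ^ 2))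
    refine this.congr_deriv ?_
    simp only [etaSlope, if_pos hx]
    field_simp
    ring
  · intro x hx
    have hx0 : 0 < x := (exp_pos 1).trans_le hx
    have hl := one_le_log_of_exp_one_le hx
    have hθ := hasDerivAt_mul_log_log (ε := ε) hx
    refine ((((hasDerivAt_log hx0.ne').const_mul β).div_const (1 + ε ^ 2)).mul
      (hθ.sin.sub (hθ.cos.const_mul ε))).congr_deriv ?_
    rw [etaSlope_of_ge hx]
    simp only [Pi.sub_apply]
    field_simp
    ring

theorem etaSlope_mem_Icc {β ε t : ℝ} (hβ : 0 < β) (hε0 : 0 < ε) (hε : ε ≤ 4) (ht : 0 < t) :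
    etaSlope β ε t ∈ Set.Icc (-β) β := by
  rcases le_total t (exp 1) with h | h
  · obtain ⟨u, rfl⟩ : ∃ u, t = exp 1 * u := ⟨t / exp 1, by field_simp⟩
    have hu0 : 0 < u := pos_of_mul_pos_right ht (exp_pos 1).le
    have hu1 : u ≤ 1 := by
      by_contra! hu
      nlinarith [exp_pos 1]
    have hk : etaSlope β ε (exp 1 * u) = -(β * (ε * (u * (1 - u)))) := by
      rw [etaSlope, if_pos h]
      field_simp
    have h1 : u * (1 - u) ≤ 1 / 4 := by nlinarith [sq_nonneg (u - 1 / 2)]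
    have h0 : 0 ≤ u * (1 - u) := mul_nonneg hu0.le (by linarith)
    have h2 : ε * (u * (1 - u)) ≤ 1 := by nlinarith
    have h3 : 0 ≤ ε * (u * (1 - u)) := by positivity
    rw [hk]
    constructor <;> nlinarith
  · rw [etaSlope_of_ge h]
    constructor <;> nlinarith [neg_one_le_sin (ε * log (log t)), sin_le_one (ε * log (log t))]

theorem abs_etaSlopeDeriv_le_div_log {β ε t : ℝ} (hβε : 0 ≤ β * ε) (ht : exp 1 ≤ t) :
    |etaSlopeDeriv β ε t| ≤ β * ε / log t := by
  have hl : 0 < log t := one_pos.trans_le (one_le_log_of_exp_one_le ht)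
  rw [etaSlopeDeriv_of_ge ht, abs_div, abs_mul, abs_of_nonneg hβε, abs_of_pos hl]
  exact div_le_div_of_nonneg_right (mul_le_of_le_one_right hβε (abs_cos_le_one _)) hl.le

theorem abs_etaSlopeDeriv_le {β ε t : ℝ} (hβ : 0 < β) (hε0 : 0 < ε) (ht : 0 < t) :
    |etaSlopeDeriv β ε t| ≤ β * ε := by
  have hβε : 0 < β * ε := mul_pos hβ hε0
  rcases le_total t (exp 1) with h | h
  · obtain ⟨u, rfl⟩ : ∃ u, t = exp 1 * u := ⟨t / exp 1, by field_simp⟩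
    have hu0 : 0 < u := pos_of_mul_pos_right ht (exp_pos 1).le
    have hu1 : u ≤ 1 := by
      by_contra! hu
      nlinarith [exp_pos 1]
    have hk : etaSlopeDeriv β ε (exp 1 * u) = -((β * ε) * (u * (1 - 2 * u))) := by
      rw [etaSlopeDeriv, if_pos h]
      field_simp
    rw [hk, abs_neg, abs_mul, abs_of_pos hβε]
    refine mul_le_of_le_one_right hβε.le (abs_le.mpr ⟨?_, ?_⟩) <;> nlinarith
  · have hl := one_le_log_of_exp_one_le h
    exact (abs_etaSlopeDeriv_le_div_log hβε.le h).trans (div_le_self hβε.le hl)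

/-- For the pathological Young function `Ψ(t) = t^α e^{η(t)}` of Lemma A.1, the second
index function `t ↦ t Ψ''(t)/Ψ'(t)` satisfies the chain
`q - 1 - βε < inf_{t>0} ≤ liminf_{t→∞} = q - 1 < p - 1 = limsup_{t→∞} ≤ sup_{t>0}
 < p - 1 + βε`, where `β = (p-q)/2`. -/
theorem stmt_5 (p q ε : ℝ) (hq : 1 < q) (hpq : q < p)
    (hε0 : 0 < ε) (hε : ε < min 4 ((q - 1) / ((p - q) / 2)))
    (η Ψ : ℝ → ℝ)
    (hη1 : ∀ t : ℝ, 0 ≤ t → t ≤ Real.exp 1 →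
      η t = (p - q) / 2 * ε / (2 * Real.exp 1 ^ 2) * (Real.exp 1 - t) ^ 2
            - (p - q) / 2 * ε / (1 + ε ^ 2))
    (hη2 : ∀ t : ℝ, Real.exp 1 ≤ t →
      η t = (p - q) / 2 * Real.log t / (1 + ε ^ 2) *
        (Real.sin (ε * Real.log (Real.log t)) - ε * Real.cos (ε * Real.log (Real.log t))))
    (hΨ : ∀ t : ℝ, 0 ≤ t → Ψ t = t ^ ((p + q) / 2) * Real.exp (η t)) :
    q - 1 - (p - q) / 2 * ε
        < sInf ((fun t => t * deriv (deriv Ψ) t / deriv Ψ t) '' Set.Ioi 0) ∧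
    sInf ((fun t => t * deriv (deriv Ψ) t / deriv Ψ t) '' Set.Ioi 0)
        ≤ Filter.liminf (fun t => t * deriv (deriv Ψ) t / deriv Ψ t) atTop ∧
    Filter.liminf (fun t => t * deriv (deriv Ψ) t / deriv Ψ t) atTop = q - 1 ∧
    q - 1 < p - 1 ∧
    Filter.limsup (fun t => t * deriv (deriv Ψ) t / deriv Ψ t) atTop = p - 1 ∧
    Filter.limsup (fun t => t * deriv (deriv Ψ) t / deriv Ψ t) atTop
        ≤ sSup ((fun t => t * deriv (deriv Ψ) t / deriv Ψ t) '' Set.Ioi 0) ∧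
    sSup ((fun t => t * deriv (deriv Ψ) t / deriv Ψ t) '' Set.Ioi 0)
        < p - 1 + (p - q) / 2 * ε := by
  obtain ⟨hε4, -⟩ := lt_min_iff.mp hε
  set β := (p - q) / 2 with hβdef
  have hβ : 0 < β := by rw [hβdef]; linarith
  have hα : (p + q) / 2 = q + β := by rw [hβdef]; ring
  have hp : p = q + 2 * β := by rw [hβdef]; ring
  have hq0 : 0 < q := by linarith
  have hβε : 0 < β * ε := mul_pos hβ hε0
  rw [hα] at hΨ
  set F : ℝ → ℝ := fun t => t * deriv (deriv Ψ) t / deriv Ψ t with hF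
  have hmem : ∀ t : ℝ, 0 < t → etaSlope β ε t ∈ Set.Icc (-β) β :=
    fun t ht => etaSlope_mem_Icc hβ hε0 hε4.le ht
  have hFeq : ∀ t : ℝ, 0 < t → F t =
      q + β + etaSlope β ε t - 1 + etaSlopeDeriv β ε t / (q + β + etaSlope β ε t) :=
    fun t ht => index_rpow_mul_exp hΨ (fun x hx => hasDerivAt_eta hη1 hη2 hx)
      (fun x hx => hasDerivAt_etaSlope β ε hx) ht (by linarith [(hmem t ht).1])
  have hquot : ∀ t : ℝ, 0 < t →
      |etaSlopeDeriv β ε t / (q + β + etaSlope β ε t)| ≤ |etaSlopeDeriv β ε t| / q := by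
    intro t ht
    have h1 : q ≤ q + β + etaSlope β ε t := by linarith [(hmem t ht).1]
    rw [abs_div, abs_of_pos (hq0.trans_le h1)]
    exact div_le_div_of_nonneg_left (abs_nonneg _) hq0 h1
  have hbound : ∀ t : ℝ, 0 < t → q - 1 - |etaSlopeDeriv β ε t| / q ≤ F t ∧
      F t ≤ p - 1 + |etaSlopeDeriv β ε t| / q := by
    intro t ht
    have h1 := hmem t ht
    have h2 := abs_le.mp (hquot t ht)
    rw [hFeq t ht]
    constructor <;> linarith [h1.1, h1.2, h2.1, h2.2]
  have hunif : ∀ t : ℝ, 0 < t → q - 1 - β * ε / q ≤ F t ∧ F t ≤ p - 1 + β * ε / q := by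
    intro t ht
    have h1 := hbound t ht
    have h2 : |etaSlopeDeriv β ε t| / q ≤ β * ε / q :=
      div_le_div_of_nonneg_right (abs_etaSlopeDeriv_le hβ hε0 ht) hq0.le
    constructor <;> linarith [h1.1, h1.2]
  have hlt : β * ε / q < β * ε := div_lt_self hβε hq
  have hbelow : BddBelow (F '' Set.Ioi 0) :=
    ⟨_, Set.forall_mem_image.mpr fun t ht => (hunif t ht).1⟩
  have habove : BddAbove (F '' Set.Ioi 0) :=
    ⟨_, Set.forall_mem_image.mpr fun t ht => (hunif t ht).2⟩
  have hne : (F '' Set.Ioi 0).Nonempty := Set.nonempty_Ioi.image F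
  have hr : Tendsto (fun t => |etaSlopeDeriv β ε t| / q) atTop (𝓝 0) := by
    refine squeeze_zero' (Eventually.of_forall fun t => by positivity) ?_
      (tendsto_log_atTop.const_div_atTop (β * ε / q))
    filter_upwards [eventually_ge_atTop (exp 1)] with t ht
    rw [div_right_comm (β * ε)]
    exact div_le_div_of_nonneg_right (abs_etaSlopeDeriv_le_div_log hβε.le ht) hq0.le
  have hfreq : ∀ x : ℝ, cos x = 0 → ∃ᶠ t in atTop, F t = q + β + β * sin x - 1 := by
    intro x hx
    refine ((frequently_sin_cos_log_log hε0 x).and_eventually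
      (eventually_ge_atTop (exp 1))).mono ?_
    rintro t ⟨⟨hs, hc⟩, ht⟩
    rw [hFeq t ((exp_pos 1).trans_le ht), etaSlope_of_ge ht, etaSlopeDeriv_of_ge ht, hs, hc, hx]
    simp
  have hliminf : liminf F atTop = q - 1 := by
    refine liminf_eq_of_frequently_le ((hfreq (-(π / 2)) (by simp)).mono fun t ht => ?_)
      ((eventually_gt_atTop 0).mono fun t ht => (hbound t ht).1) hr
    rw [ht, sin_neg, sin_pi_div_two]
    linarith
  have hlimsup : limsup F atTop = p - 1 := by
    refine limsup_eq_of_frequently_le ((hfreq (π / 2) cos_pi_div_two).mono fun t ht => ?_)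
      ((eventually_gt_atTop 0).mono fun t ht => (hbound t ht).2) hr
    rw [ht, sin_pi_div_two]
    linarith
  have hbu : IsBoundedUnder (· ≤ ·) atTop F :=
    ⟨_, eventually_map.mpr ((eventually_gt_atTop 0).mono fun t ht => (hunif t ht).2)⟩
  have hbl : IsBoundedUnder (· ≥ ·) atTop F :=
    ⟨_, eventually_map.mpr ((eventually_gt_atTop 0).mono fun t ht => (hunif t ht).1)⟩
  refine ⟨?_, ?_, hliminf, by linarith, hlimsup, ?_, ?_⟩
  · have := le_csInf hne (Set.forall_mem_image.mpr fun t ht => (hunif t ht).1)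
    linarith
  · exact le_liminf_of_le hbu.isCoboundedUnder_ge
      ((eventually_gt_atTop 0).mono fun t ht => csInf_le hbelow (Set.mem_image_of_mem F ht))
  · exact limsup_le_of_le hbl.isCoboundedUnder_le
      ((eventually_gt_atTop 0).mono fun t ht => le_csSup habove (Set.mem_image_of_mem F ht))
  · have := csSup_le hne (Set.forall_mem_image.mpr fun t ht => (hunif t ht).2)
    linarith
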